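/- arXiv:2209.12273 — 5 statements merged into one kernel-verified Lean document; each statement's English description precedes it below -/
import Mathlib

section
/- Let q ≥ 1 and p ≥ 1. Let F₁ ⊆ E be feasible for (p,q−1)-Flex-Steiner with terminal set T. Call a set A ⊆ V violated (with respect to F₁) if A ∩ T ≠ ∅, T \ A ≠ ∅, |δ_{F₁∩𝒮}(A)| < p and |δ_{F₁}(A)| = p+q−1. Suppose F₂ ⊆ E \ F₁ covers all violated sets, i.e., δ_{F₂}(A) ≠ ∅ for every violated A. Then F₁ ∪ F₂ is feasible for (p,q)-Flex-Steiner with terminal set T. -/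
open scoped BigOperators

/-- An edge `e` crosses the vertex set `A` if exactly one of its endpoints lies in `A`. -/
def crosses {V E : Type*} (ends : E → Sym2 V) (A : Set V) (e : E) : Prop :=
  ∃ u v : V, ends e = s(u, v) ∧ u ∈ A ∧ v ∉ A

/-- `cut ends F A` is `δ_F(A)`: the set of edges of `F` with exactly one endpoint in `A`. -/
def cut {V E : Type*} (ends : E → Sym2 V) (F : Set E) (A : Set V) : Set E :=
  {e | e ∈ F ∧ crosses ends A e}

/-- Feasibility for `(p,q)`-Flex-Steiner with terminal set `T`. -/
def steinerFeasible {V E : Type*} (ends : E → Sym2 V) (𝒮 : Set E) (T : Set V)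
    (p q : ℕ) (F : Set E) : Prop :=
  ∀ A : Set V, (A ∩ T).Nonempty → (T \ A).Nonempty →
    p ≤ (cut ends (F ∩ 𝒮) A).ncard ∨ p + q ≤ (cut ends F A).ncard

/-- Cuts are monotone in the edge set. -/
theorem cut_mono {V E : Type*} (ends : E → Sym2 V) (A : Set V) {F F' : Set E} (h : F ⊆ F') :
    cut ends F A ⊆ cut ends F' A :=
  fun _ he => ⟨h he.1, he.2⟩

theorem stmt0 {V E : Type*} [Fintype V] [Fintype E]
    (ends : E → Sym2 V) (𝒮 𝒰 : Set E)
    (hpart : 𝒮 ∪ 𝒰 = Set.univ) (hdisj : Disjoint 𝒮 𝒰)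
    (T : Set V) (p q : ℕ) (hp : 1 ≤ p) (hq : 1 ≤ q)
    (F₁ : Set E) (hF₁ : steinerFeasible ends 𝒮 T p (q - 1) F₁)
    (F₂ : Set E) (hF₂ : F₂ ⊆ Set.univ \ F₁)
    (hcover : ∀ A : Set V, (A ∩ T).Nonempty → (T \ A).Nonempty →
      (cut ends (F₁ ∩ 𝒮) A).ncard < p → (cut ends F₁ A).ncard = p + q - 1 →
      (cut ends F₂ A).Nonempty) :
    steinerFeasible ends 𝒮 T p q (F₁ ∪ F₂) := by
  intro A hA hTA
  have hcut : cut ends F₁ A ⊆ cut ends (F₁ ∪ F₂) A :=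
    cut_mono ends A Set.subset_union_left
  have hle := Set.ncard_le_ncard hcut
  by_cases hsafe : p ≤ (cut ends (F₁ ∩ 𝒮) A).ncard
  · exact Or.inl (hsafe.trans (Set.ncard_le_ncard (cut_mono ends A
      (Set.inter_subset_inter_left 𝒮 Set.subset_union_left))))
  · right
    have hF₁A := (hF₁ A hA hTA).resolve_left hsafe
    by_cases hviol : (cut ends F₁ A).ncard = p + q - 1
    · obtain ⟨e, he⟩ := hcover A hA hTA (not_le.mp hsafe) hviol
      have hlt : (cut ends F₁ A).ncard < (cut ends (F₁ ∪ F₂) A).ncard :=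
        Set.ncard_lt_ncard ((Set.ssubset_iff_of_subset hcut).mpr
          ⟨e, cut_mono ends A Set.subset_union_right he, fun h => (hF₂ he.1).2 h.1⟩)
      omega
    · omega
end

section
/- Let s ≠ t be vertices and let F ⊆ E satisfy the capacity condition for (s,t). Let 𝒞 be the family of violated cuts of F. If A, B ∈ 𝒞 properly intersect, then either (A ∩ B ∈ 𝒞 and A ∪ B ∈ 𝒞), or one of δ_F(A ∪ B) and δ_F(A ∩ B) consists of exactly two safe edges and no unsafe edges while the other consists of exactly four unsafe edges and no safe edges. -/
open scoped BigOperators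

/-- Two vertex sets properly intersect. -/
def properlyIntersect {V : Type*} (A B : Set V) : Prop :=
  (A ∩ B).Nonempty ∧ (A \ B).Nonempty ∧ (B \ A).Nonempty

/-- `F` satisfies the capacity condition for the pair `(s,t)`. -/
def capCond {V E : Type*} (ends : E → Sym2 V) (𝒮 𝒰 : Set E) (s t : V) (F : Set E) : Prop :=
  ∀ A : Set V, s ∈ A → t ∉ A →
    4 ≤ 2 * (cut ends (F ∩ 𝒮) A).ncard + (cut ends (F ∩ 𝒰) A).ncard

/-- The family of violated cuts of `F` for the `(2,2)`-Flex-ST augmentation. -/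
def violatedST {V E : Type*} (ends : E → Sym2 V) (𝒮 𝒰 : Set E) (s t : V) (F : Set E) :
    Set (Set V) :=
  {A | s ∈ A ∧ t ∉ A ∧ (cut ends (F ∩ 𝒮) A).ncard = 1 ∧ (cut ends (F ∩ 𝒰) A).ncard = 2}

theorem crosses_iff_of_ends_eq {V E : Type*} {ends : E → Sym2 V} {A : Set V} {e : E} {u v : V}
    (h : ends e = s(u, v)) :
    crosses ends A e ↔ (u ∈ A ∧ v ∉ A) ∨ (v ∈ A ∧ u ∉ A) := by
  constructor
  · rintro ⟨x, y, hxy, hx, hy⟩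
    rw [h, Sym2.eq_iff] at hxy
    rcases hxy with ⟨rfl, rfl⟩ | ⟨rfl, rfl⟩
    · exact Or.inl ⟨hx, hy⟩
    · exact Or.inr ⟨hx, hy⟩
  · rintro (⟨hu, hv⟩ | ⟨hv, hu⟩)
    · exact ⟨u, v, h, hu, hv⟩
    · exact ⟨v, u, h.trans Sym2.eq_swap, hv, hu⟩

theorem cut_inter_union_cut_union_subset {V E : Type*} (ends : E → Sym2 V) (F : Set E)
    (A B : Set V) :
    cut ends F (A ∩ B) ∪ cut ends F (A ∪ B) ⊆ cut ends F A ∪ cut ends F B := by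
  intro e he
  obtain ⟨u, v, h⟩ : ∃ u v, ends e = s(u, v) := by
    induction h : ends e with
    | _ u v => exact ⟨u, v, rfl⟩
  simp only [cut, Set.mem_union, Set.mem_ofPred_eq, crosses_iff_of_ends_eq h,
    Set.mem_inter_iff] at he ⊢
  tauto

theorem cut_inter_inter_cut_union_subset {V E : Type*} (ends : E → Sym2 V) (F : Set E)
    (A B : Set V) :
    cut ends F (A ∩ B) ∩ cut ends F (A ∪ B) ⊆ cut ends F A ∩ cut ends F B := by
  intro e he
  obtain ⟨u, v, h⟩ : ∃ u v, ends e = s(u, v) := by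
    induction h : ends e with
    | _ u v => exact ⟨u, v, rfl⟩
  simp only [cut, Set.mem_union, Set.mem_ofPred_eq, crosses_iff_of_ends_eq h,
    Set.mem_inter_iff] at he ⊢
  tauto

/-- The cut function of a finite multigraph is submodular. -/
theorem ncard_cut_inter_add_ncard_cut_union_le {V E : Type*} [Finite E] (ends : E → Sym2 V)
    (F : Set E) (A B : Set V) :
    (cut ends F (A ∩ B)).ncard + (cut ends F (A ∪ B)).ncard ≤
      (cut ends F A).ncard + (cut ends F B).ncard := by
  rw [← Set.ncard_union_add_ncard_inter (cut ends F (A ∩ B)) (cut ends F (A ∪ B)),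
    ← Set.ncard_union_add_ncard_inter (cut ends F A) (cut ends F B)]
  exact add_le_add (Set.ncard_le_ncard (cut_inter_union_cut_union_subset ends F A B))
    (Set.ncard_le_ncard (cut_inter_inter_cut_union_subset ends F A B))

theorem stmt2 {V E : Type*} [Fintype V] [Fintype E]
    (ends : E → Sym2 V) (𝒮 𝒰 : Set E)
    (hpart : 𝒮 ∪ 𝒰 = Set.univ) (hdisj : Disjoint 𝒮 𝒰)
    (s t : V) (hst : s ≠ t)
    (F : Set E) (hF : capCond ends 𝒮 𝒰 s t F)
    (A B : Set V)
    (hA : A ∈ violatedST ends 𝒮 𝒰 s t F) (hB : B ∈ violatedST ends 𝒮 𝒰 s t F)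
    (hAB : properlyIntersect A B) :
    (A ∩ B ∈ violatedST ends 𝒮 𝒰 s t F ∧ A ∪ B ∈ violatedST ends 𝒮 𝒰 s t F) ∨
    ((cut ends (F ∩ 𝒮) (A ∩ B)).ncard = 2 ∧ (cut ends (F ∩ 𝒰) (A ∩ B)).ncard = 0 ∧
      (cut ends (F ∩ 𝒮) (A ∪ B)).ncard = 0 ∧ (cut ends (F ∩ 𝒰) (A ∪ B)).ncard = 4) ∨
    ((cut ends (F ∩ 𝒮) (A ∪ B)).ncard = 2 ∧ (cut ends (F ∩ 𝒰) (A ∪ B)).ncard = 0 ∧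
      (cut ends (F ∩ 𝒮) (A ∩ B)).ncard = 0 ∧ (cut ends (F ∩ 𝒰) (A ∩ B)).ncard = 4) := by
  obtain ⟨hsA, htA, hSA, hUA⟩ := hA
  obtain ⟨hsB, htB, hSB, hUB⟩ := hB
  have hsI : s ∈ A ∩ B := ⟨hsA, hsB⟩
  have htI : t ∉ A ∩ B := fun h => htA h.1
  have hsJ : s ∈ A ∪ B := Or.inl hsA
  have htJ : t ∉ A ∪ B := fun h => h.elim htA htB
  have hI := hF _ hsI htI
  have hJ := hF _ hsJ htJ
  have hS := ncard_cut_inter_add_ncard_cut_union_le ends (F ∩ 𝒮) A B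
  have hU := ncard_cut_inter_add_ncard_cut_union_le ends (F ∩ 𝒰) A B
  simp only [violatedST, Set.mem_ofPred_eq, hsI, htI, hsJ, htJ, not_false_eq_true, true_and]
  omega
end

section
/- Let s ≠ t be vertices, let F ⊆ E satisfy the capacity condition for (s,t), and suppose the family 𝒞 of violated cuts of F is nonempty. Let 𝒮' = {e ∈ F ∩ 𝒮 : e ∈ δ_F(A) for some A ∈ 𝒞} be the set of safe edges of F crossing at least one violated cut. Then there exist three s-t paths P₁, P₂, P₃ in (V,F) such that every edge of 𝒮' lies on at least one of P₁, P₂, P₃. -/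
open scoped BigOperators

/-- An `s`-`t` path in `(V, F)`: pairwise distinct vertices `v 0 = s, …, v k = t` together with
pairwise distinct edges `es 0, …, es (k-1)` of `F`, where `es i` joins `v i` and `v (i+1)`. -/
def IsSTPath {V E : Type*} (ends : E → Sym2 V) (F : Set E) (s t : V) (k : ℕ)
    (v : Fin (k + 1) → V) (es : Fin k → E) : Prop :=
  Function.Injective v ∧ Function.Injective es ∧
  v 0 = s ∧ v (Fin.last k) = t ∧
  ∀ i : Fin k, es i ∈ F ∧ ends (es i) = s(v i.castSucc, v i.succ)

open scoped Classical in
/-- The net amount of `f` leaving `A`, where the edge `e` is oriented from `a e` to `b e`. -/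
noncomputable def netOut {V E : Type*} [Fintype E] (a b : E → V) (f : E → ℤ) (A : Set V) : ℤ :=
  ∑ e, f e * ((if a e ∈ A then 1 else 0) - (if b e ∈ A then 1 else 0))

/-- The arc obtained by traversing `e` along (`σ = 1`) or against (`σ = -1`) its orientation
goes from `u` to `w`. -/
def IsArc {V E : Type*} (a b : E → V) (e : E) (σ : ℤ) (u w : V) : Prop :=
  (σ = 1 ∧ a e = u ∧ b e = w) ∨ (σ = -1 ∧ b e = u ∧ a e = w)

/-- `X` is the edge set of an `s`-`t` path. -/
def IsPathEdgeSet {V E : Type*} (ends : E → Sym2 V) (s t : V) (X : Set E) : Prop :=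
  ∃ (k : ℕ) (v : Fin (k + 1) → V) (es : Fin k → E),
    IsSTPath ends Set.univ s t k v es ∧ X = Set.range es

theorem netOut_add {V E : Type*} [Fintype E] (a b : E → V) (f g : E → ℤ) (A : Set V) :
    netOut a b (fun e => f e + g e) A = netOut a b f A + netOut a b g A := by
  simp only [netOut, add_mul, Finset.sum_add_distrib]

theorem netOut_sub {V E : Type*} [Fintype E] (a b : E → V) (f g : E → ℤ) (A : Set V) :
    netOut a b (fun e => f e - g e) A = netOut a b f A - netOut a b g A := by
  simp only [netOut, sub_mul, Finset.sum_sub_distrib]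

/-- Either `t` is reachable from `s` by an injective sequence of `R`-steps, or some set separating
`s` from `t` is closed under `R`. -/
theorem exists_closed_or_exists_injOn_chain {V : Type*} (R : V → V → Prop) (s t : V) :
    (∃ A : Set V, s ∈ A ∧ t ∉ A ∧ ∀ u w, u ∈ A → R u w → w ∈ A) ∨
    ∃ (k : ℕ) (v : ℕ → V), v 0 = s ∧ v k = t ∧ Set.InjOn v (Set.Iic k) ∧
      ∀ i < k, R (v i) (v (i + 1)) := by
  let A : Set V := {x | ∃ (k : ℕ) (v : ℕ → V), v 0 = s ∧ v k = x ∧ Set.InjOn v (Set.Iic k) ∧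
      ∀ i < k, R (v i) (v (i + 1))}
  by_cases ht : t ∈ A
  · exact Or.inr ht
  refine Or.inl ⟨A, ⟨0, fun _ => s, rfl, rfl, ?_, by simp⟩, ht, ?_⟩
  · intro i hi j hj _
    simp only [Set.mem_Iic] at hi hj
    omega
  rintro u w ⟨k, v, h0, hk, hinj, hR⟩ huw
  by_cases hw : ∃ i ≤ k, v i = w
  · obtain ⟨i, hi, rfl⟩ := hw
    exact ⟨i, v, h0, rfl, hinj.mono (Set.Iic_subset_Iic.2 hi), fun j hj => hR j (by omega)⟩
  · push Not at hw
    refine ⟨k + 1, fun i => if i ≤ k then v i else w, by simpa using h0, by simp, ?_, ?_⟩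
    · intro i hi j hj hij
      simp only [Set.mem_Iic] at hi hj
      dsimp only at hij
      split_ifs at hij with h1 h2 h2
      · exact hinj h1 h2 hij
      · exact absurd hij (hw i h1)
      · exact absurd hij.symm (hw j h2)
      · omega
    · intro i hi
      rcases Nat.lt_succ_iff_lt_or_eq.1 hi with h | rfl
      · simpa [h.le, Nat.succ_le_of_lt h] using hR i h
      · simpa [hk] using huw

/-- Either there is an `s`-`t` path all of whose arcs are admissible, with signed incidence
vector `χ`, or some set separating `s` from `t` is left by no admissible arc. -/
theorem exists_blocking_set_or_exists_path {V E : Type*} [Fintype E] (ends : E → Sym2 V)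
    (a b : E → V) (hab : ∀ e, ends e = s(a e, b e)) (ok : E → ℤ → Prop) (s t : V) :
    (∃ A : Set V, s ∈ A ∧ t ∉ A ∧ ∀ e σ u w, IsArc a b e σ u w → u ∈ A → w ∉ A → ¬ ok e σ) ∨
    ∃ (X : Set E) (χ : E → ℤ), IsPathEdgeSet ends s t X ∧
      (∀ e ∉ X, χ e = 0) ∧ (∀ e ∈ X, (χ e = 1 ∨ χ e = -1) ∧ ok e (χ e)) ∧
      ∀ A : Set V, s ∈ A → t ∉ A → netOut a b χ A = 1 := by
  classical
  rcases exists_closed_or_exists_injOn_chain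
    (fun u w => ∃ e σ, IsArc a b e σ u w ∧ ok e σ) s t with
    ⟨A, hs, ht, hA⟩ | ⟨k, v, h0, hk, hinj, hR⟩
  · exact Or.inl ⟨A, hs, ht, fun e σ u w harc hu hw hok => hw (hA u w hu ⟨e, σ, harc, hok⟩)⟩
  right
  choose es σ harc hok using fun i : Fin k => hR i i.2
  have hends : ∀ i, ends (es i) = s(v i, v (i + 1)) := by
    intro i
    rcases harc i with ⟨-, h1, h2⟩ | ⟨-, h1, h2⟩
    · rw [hab, h1, h2]
    · rw [hab, h1, h2, Sym2.eq_swap]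
  have hes : Function.Injective es := by
    intro i j hij
    have h := (hends i).symm.trans ((congrArg ends hij).trans (hends j))
    have hi := i.2
    have hj := j.2
    ext
    rcases Sym2.eq_iff.1 h with ⟨h1, -⟩ | ⟨h1, h2⟩
    · exact hinj (Set.mem_Iic.2 hi.le) (Set.mem_Iic.2 hj.le) h1
    · have h3 := hinj (Set.mem_Iic.2 hi.le) (Set.mem_Iic.2 (Nat.succ_le_of_lt hj)) h1
      have h4 := hinj (Set.mem_Iic.2 (Nat.succ_le_of_lt hi)) (Set.mem_Iic.2 hj.le) h2
      omega
  have hχ : ∀ i, (∑ j, if es j = es i then σ j else 0) = σ i := by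
    intro i
    simp [hes.eq_iff]
  refine ⟨Set.range es, fun e => ∑ i, if es i = e then σ i else 0,
    ⟨k, fun i => v i, es, ⟨?_, hes, by simpa using h0, by simpa using hk, ?_⟩, rfl⟩, ?_, ?_, ?_⟩
  · intro i j hij
    exact Fin.ext (hinj (Set.mem_Iic.2 (Nat.lt_succ_iff.1 i.2))
      (Set.mem_Iic.2 (Nat.lt_succ_iff.1 j.2)) hij)
  · intro i
    simpa using hends i
  · intro e he
    exact Finset.sum_eq_zero fun i _ => if_neg fun h => he ⟨i, h⟩
  · rintro _ ⟨i, rfl⟩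
    simp only [hχ]
    exact ⟨(harc i).imp And.left And.left, hok i⟩
  · intro A hs ht
    have hterm : ∀ i : Fin k, σ i * ((if a (es i) ∈ A then 1 else 0) -
        (if b (es i) ∈ A then 1 else 0)) =
        (if v i ∈ A then (1 : ℤ) else 0) - (if v (i + 1) ∈ A then 1 else 0) := by
      intro i
      rcases harc i with ⟨h, h1, h2⟩ | ⟨h, h1, h2⟩ <;> rw [h, h1, h2] <;> ring
    have hsum : netOut a b (fun e => ∑ i, if es i = e then σ i else 0) A =
        ∑ i : Fin k, σ i * ((if a (es i) ∈ A then 1 else 0) -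
        (if b (es i) ∈ A then 1 else 0)) := by
      simp only [netOut, Finset.sum_mul, ite_mul, zero_mul]
      rw [Finset.sum_comm]
      simp
    rw [hsum, Finset.sum_congr rfl fun i _ => hterm i,
      Fin.sum_univ_eq_sum_range
        (fun i => (if v i ∈ A then (1 : ℤ) else 0) - (if v (i + 1) ∈ A then 1 else 0)) k,
      Finset.sum_range_sub', h0, hk]
    simp [hs, ht]

open scoped Classical in
/-- If every `s`-`t` cut has capacity at least `k`, there is an integral flow of value `k`. -/
theorem exists_flow {V E : Type*} [Fintype E] (ends : E → Sym2 V)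
    (a b : E → V) (hab : ∀ e, ends e = s(a e, b e)) (c : E → ℕ) (s t : V) (k : ℕ)
    (hcut : ∀ A : Set V, s ∈ A → t ∉ A → k ≤ ∑ e, if crosses ends A e then c e else 0) :
    ∃ f : E → ℤ, (∀ e, |f e| ≤ c e) ∧
      ∀ A : Set V, s ∈ A → t ∉ A → netOut a b f A = k := by
  suffices h : ∀ j ≤ k, ∃ f : E → ℤ, (∀ e, |f e| ≤ c e) ∧
      ∀ A : Set V, s ∈ A → t ∉ A → netOut a b f A = j from h k le_rfl
  intro j
  induction j with
  | zero => exact fun _ => ⟨fun _ => 0, by simp, by simp [netOut]⟩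
  | succ j ih =>
    intro hj
    obtain ⟨f, hf, hnet⟩ := ih (by omega)
    rcases exists_blocking_set_or_exists_path ends a b hab (fun e σ => σ * f e < c e) s t with
      ⟨A, hs, ht, hA⟩ | ⟨X, χ, -, hX0, hX1, hχ⟩
    · exfalso
      have h1 := hnet A hs ht
      have h2 : ((∑ e, if crosses ends A e then c e else 0 : ℕ) : ℤ) ≤ netOut a b f A := by
        rw [Nat.cast_sum]
        refine Finset.sum_le_sum fun e _ => ?_
        by_cases ha : a e ∈ A <;> by_cases hb : b e ∈ A
        · have : ¬ crosses ends A e := by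
            rintro ⟨u, w, h, hu, hw⟩
            rw [hab] at h
            rcases Sym2.eq_iff.1 h with ⟨rfl, rfl⟩ | ⟨rfl, rfl⟩ <;> contradiction
          simp [ha, hb, this]
        · have := hA e 1 _ _ (Or.inl ⟨rfl, rfl, rfl⟩) ha hb
          simp only [ha, hb, if_true, if_false]
          split_ifs <;> push_cast <;> omega
        · have := hA e (-1) _ _ (Or.inr ⟨rfl, rfl, rfl⟩) hb ha
          simp only [ha, hb, if_true, if_false]
          split_ifs <;> push_cast <;> omega
        · have : ¬ crosses ends A e := by
            rintro ⟨u, w, h, hu, hw⟩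
            rw [hab] at h
            rcases Sym2.eq_iff.1 h with ⟨rfl, rfl⟩ | ⟨rfl, rfl⟩ <;> contradiction
          simp [ha, hb, this]
      have h3 := hcut A hs ht
      omega
    · refine ⟨fun e => f e + χ e, fun e => ?_, fun A hs ht => ?_⟩
      · dsimp only
        have h := abs_le.1 (hf e)
        by_cases he : e ∈ X
        · obtain ⟨h1 | h1, h2⟩ := hX1 e he <;> rw [h1] at h2 ⊢ <;> rw [abs_le] <;>
            constructor <;> omega
        · simpa [hX0 e he] using hf e
      · rw [netOut_add, hnet A hs ht, hχ A hs ht]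
        push_cast
        rfl

open scoped Classical in
/-- An integral flow of value `k` dominates the total load of some `k` paths. -/
theorem exists_paths_of_flow {V E : Type*} [Fintype E] (ends : E → Sym2 V)
    (a b : E → V) (hab : ∀ e, ends e = s(a e, b e)) (s t : V) (k : ℕ) (f : E → ℤ)
    (hnet : ∀ A : Set V, s ∈ A → t ∉ A → netOut a b f A = k) :
    ∃ P : Fin k → Set E, (∀ i, IsPathEdgeSet ends s t (P i)) ∧
      ∀ e, (∑ i, if e ∈ P i then (1 : ℤ) else 0) ≤ |f e| := by
  induction k generalizing f with
  | zero => exact ⟨Fin.elim0, fun i => i.elim0, by simp⟩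
  | succ k ih =>
    rcases exists_blocking_set_or_exists_path ends a b hab (fun e σ => 0 < σ * f e) s t with
      ⟨A, hs, ht, hA⟩ | ⟨X, χ, hX, hX0, hX1, hχ⟩
    · exfalso
      have h1 := hnet A hs ht
      have h2 : netOut a b f A ≤ 0 := by
        refine Finset.sum_nonpos fun e _ => ?_
        by_cases ha : a e ∈ A <;> by_cases hb : b e ∈ A
        · simp [ha, hb]
        · have := hA e 1 _ _ (Or.inl ⟨rfl, rfl, rfl⟩) ha hb
          simp only [ha, hb, if_true, if_false]
          omega
        · have := hA e (-1) _ _ (Or.inr ⟨rfl, rfl, rfl⟩) hb ha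
          simp only [ha, hb, if_true, if_false]
          omega
        · simp [ha, hb]
      omega
    · obtain ⟨P, hP, hload⟩ := ih (fun e => f e - χ e) fun A hs ht => by
        rw [netOut_sub, hnet A hs ht, hχ A hs ht]
        push_cast
        ring
      refine ⟨Fin.cons X P, Fin.cases hX hP, fun e => ?_⟩
      have h := hload e
      rw [Fin.sum_univ_succ]
      simp only [Fin.cons_zero, Fin.cons_succ]
      by_cases he : e ∈ X
      · rw [if_pos he]
        obtain ⟨h1 | h1, h2⟩ := hX1 e he <;> rw [h1] at h h2 <;>
          rcases abs_cases (f e) with h3 | h3 <;>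
          rcases abs_cases (f e - χ e) with h4 | h4 <;> rw [h1] at h4 <;> omega
      · rw [if_neg he]
        simpa [hX0 e he] using h

open scoped Classical in
/-- Edge version of Menger's theorem for undirected multigraphs with edge capacities. -/
theorem exists_paths_of_le_cut {V E : Type*} [Fintype E] (ends : E → Sym2 V)
    (c : E → ℕ) (s t : V) (k : ℕ)
    (hcut : ∀ A : Set V, s ∈ A → t ∉ A → k ≤ ∑ e, if crosses ends A e then c e else 0) :
    ∃ P : Fin k → Set E, (∀ i, IsPathEdgeSet ends s t (P i)) ∧
      ∀ e, (∑ i, if e ∈ P i then 1 else 0) ≤ c e := by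
  have hends : ∀ e, ∃ a b, ends e = s(a, b) := fun e => by
    induction h : ends e with
    | h x y => exact ⟨x, y, rfl⟩
  choose a b hab using hends
  obtain ⟨f, hf, hnet⟩ := exists_flow ends a b hab c s t k hcut
  obtain ⟨P, hP, hload⟩ := exists_paths_of_flow ends a b hab s t k f hnet
  exact ⟨P, hP, fun e => by exact_mod_cast (hload e).trans (hf e)⟩

theorem IsPathEdgeSet.exists_crosses {V E : Type*} {ends : E → Sym2 V} {s t : V} {X : Set E}
    (hX : IsPathEdgeSet ends s t X) {A : Set V} (hs : s ∈ A) (ht : t ∉ A) :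
    ∃ e ∈ X, crosses ends A e := by
  obtain ⟨k, v, es, ⟨-, -, h0, hk, h⟩, rfl⟩ := hX
  by_contra! hno
  have hall : ∀ i, v i ∈ A := by
    intro i
    induction i using Fin.induction with
    | zero => rwa [h0]
    | succ i ih =>
      by_contra hi
      exact hno _ ⟨i, rfl⟩ ⟨_, _, (h i).2, ih, hi⟩
  exact ht (hk ▸ hall _)

theorem IsPathEdgeSet.exists_isSTPath {V E : Type*} {ends : E → Sym2 V} {s t : V} {X F : Set E}
    (hX : IsPathEdgeSet ends s t X) (hXF : X ⊆ F) :
    ∃ (k : ℕ) (v : Fin (k + 1) → V) (es : Fin k → E),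
      IsSTPath ends F s t k v es ∧ ∀ e ∈ X, ∃ i, es i = e := by
  obtain ⟨k, v, es, ⟨h1, h2, h3, h4, h5⟩, rfl⟩ := hX
  exact ⟨k, v, es, ⟨h1, h2, h3, h4, fun i => ⟨hXF ⟨i, rfl⟩, (h5 i).2⟩⟩, fun e he => he⟩

open scoped Classical in
/-- The capacity of a cut, with capacities two on safe and one on unsafe edges of `F`. -/
theorem sum_crosses_capacity {V E : Type*} [Fintype E] (ends : E → Sym2 V) {𝒮 𝒰 : Set E}
    (hpart : 𝒮 ∪ 𝒰 = Set.univ) (hdisj : Disjoint 𝒮 𝒰) (F : Set E) (A : Set V) :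
    (∑ e, if crosses ends A e then (if e ∈ F then (if e ∈ 𝒮 then 2 else 1) else 0) else 0) =
      2 * (cut ends (F ∩ 𝒮) A).ncard + (cut ends (F ∩ 𝒰) A).ncard := by
  have hcard : ∀ X : Set E, X.ncard = ∑ e, if e ∈ X then 1 else 0 := fun X => by
    rw [Set.ncard_eq_toFinset_card', Finset.sum_boole]
    simp
  rw [hcard, hcard, Finset.mul_sum, ← Finset.sum_add_distrib]
  refine Finset.sum_congr rfl fun e _ => ?_
  have hU : e ∈ 𝒰 ↔ e ∉ 𝒮 :=
    ⟨fun hu hs => Set.disjoint_left.1 hdisj hs hu,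
      fun hs => ((hpart ▸ Set.mem_univ e : e ∈ 𝒮 ∪ 𝒰)).resolve_left hs⟩
  by_cases h1 : crosses ends A e <;> by_cases h2 : e ∈ F <;> by_cases h3 : e ∈ 𝒮 <;>
    simp [cut, hU, h1, h2, h3]

theorem stmt5 {V E : Type*} [Fintype V] [Fintype E]
    (ends : E → Sym2 V) (𝒮 𝒰 : Set E)
    (hpart : 𝒮 ∪ 𝒰 = Set.univ) (hdisj : Disjoint 𝒮 𝒰)
    (s t : V) (hst : s ≠ t)
    (F : Set E) (hF : capCond ends 𝒮 𝒰 s t F)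
    (hne : (violatedST ends 𝒮 𝒰 s t F).Nonempty)
    (S' : Set E)
    (hS' : S' = {e ∈ F ∩ 𝒮 | ∃ A ∈ violatedST ends 𝒮 𝒰 s t F, e ∈ cut ends F A}) :
    ∃ (k₁ : ℕ) (v₁ : Fin (k₁ + 1) → V) (es₁ : Fin k₁ → E)
      (k₂ : ℕ) (v₂ : Fin (k₂ + 1) → V) (es₂ : Fin k₂ → E)
      (k₃ : ℕ) (v₃ : Fin (k₃ + 1) → V) (es₃ : Fin k₃ → E),
      IsSTPath ends F s t k₁ v₁ es₁ ∧ IsSTPath ends F s t k₂ v₂ es₂ ∧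
      IsSTPath ends F s t k₃ v₃ es₃ ∧
      ∀ e ∈ S', (∃ i, es₁ i = e) ∨ (∃ i, es₂ i = e) ∨ (∃ i, es₃ i = e) := by
  classical
  obtain ⟨P, hP, hload⟩ := exists_paths_of_le_cut ends
    (fun e => if e ∈ F then (if e ∈ 𝒮 then 2 else 1) else 0) s t 3 fun A hs ht => by
      rw [sum_crosses_capacity ends hpart hdisj]
      exact le_trans (by norm_num) (hF A hs ht)
  have hPF : ∀ i, P i ⊆ F := by
    intro i e he
    by_contra heF
    have h := hload e
    have h1 := Finset.single_le_sum (f := fun i => if e ∈ P i then 1 else 0)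
      (fun _ _ => Nat.zero_le _) (Finset.mem_univ i)
    simp only [he, heF, if_true, if_false] at h h1
    omega
  have hcover : ∀ e ∈ S', ∃ i, e ∈ P i := by
    subst hS'
    rintro e ⟨⟨heF, heS⟩, A, ⟨hs, ht, hA1, hA2⟩, -, heA⟩
    by_contra! hno
    choose g hgP hgA using fun i => (hP i).exists_crosses hs ht
    obtain ⟨e', he'⟩ := Set.ncard_eq_one.1 hA1
    have hsafe : ∀ x ∈ cut ends (F ∩ 𝒮) A, x = e := by
      have h : e ∈ cut ends (F ∩ 𝒮) A := ⟨⟨heF, heS⟩, heA⟩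
      rw [he'] at h ⊢
      rintro x rfl
      exact h.symm
    have hgS : ∀ i, g i ∉ 𝒮 := fun i hi =>
      hno i (hsafe (g i) ⟨⟨hPF i (hgP i), hi⟩, hgA i⟩ ▸ hgP i)
    have hgU : ∀ i, g i ∈ cut ends (F ∩ 𝒰) A := fun i =>
      ⟨⟨hPF i (hgP i), (hpart ▸ Set.mem_univ (g i) : g i ∈ 𝒮 ∪ 𝒰).resolve_left (hgS i)⟩, hgA i⟩
    have hginj : Function.Injective g := by
      intro i j hij
      by_contra hne
      have h := hload (g i)
      have h1 := Finset.sum_le_sum_of_subset (f := fun l => if g i ∈ P l then 1 else 0)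
        (Finset.subset_univ {i, j})
      rw [Finset.sum_pair hne, if_pos (hgP i), if_pos (hij ▸ hgP j)] at h1
      simp only [hPF i (hgP i), hgS i, if_true, if_false] at h
      omega
    have h3 : (Set.range g).ncard = 3 := by
      rw [← Set.image_univ, Set.ncard_image_of_injective _ hginj, Set.ncard_univ]
      simp
    have h4 := Set.ncard_le_ncard (Set.range_subset_iff.2 hgU) (Set.toFinite _)
    omega
  obtain ⟨k₁, v₁, es₁, h₁, hc₁⟩ := (hP 0).exists_isSTPath (hPF 0)
  obtain ⟨k₂, v₂, es₂, h₂, hc₂⟩ := (hP 1).exists_isSTPath (hPF 1)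
  obtain ⟨k₃, v₃, es₃, h₃, hc₃⟩ := (hP 2).exists_isSTPath (hPF 2)
  refine ⟨k₁, v₁, es₁, k₂, v₂, es₂, k₃, v₃, es₃, h₁, h₂, h₃, fun e he => ?_⟩
  obtain ⟨i, hi⟩ := hcover e he
  fin_cases i
  · exact Or.inl (hc₁ e hi)
  · exact Or.inr (Or.inl (hc₂ e hi))
  · exact Or.inr (Or.inr (hc₃ e hi))
end

section
/- Let p ≥ 1, q ≤ 2 and 0 ≤ i ≤ p−1. Let H ⊆ E be feasible for (p,q)-FGC such that for every A with ∅ ≠ A ⊊ V, if |δ_H(A)| = p+q then |δ_{H∩𝒮}(A)| ≥ i. Then the family 𝒞_i = {A ⊆ V : ∅ ≠ A ⊊ V, |δ_H(A)| = p+q and |δ_{H∩𝒮}(A)| = i} is uncrossable. -/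
open scoped BigOperators

/-- `F` is feasible for `(p,q)`-FGC. -/
def fgcFeasible {V E : Type*} (ends : E → Sym2 V) (𝒮 : Set E) (p q : ℕ) (F : Set E) : Prop :=
  ∀ A : Set V, A.Nonempty → A ≠ Set.univ →
    p ≤ (cut ends (F ∩ 𝒮) A).ncard ∨ p + q ≤ (cut ends F A).ncard

/-- Two properly intersecting members of the family `𝒞` uncross. -/
def uncross {V : Type*} (𝒞 : Set (Set V)) (A B : Set V) : Prop :=
  (A ∩ B ∈ 𝒞 ∧ A ∪ B ∈ 𝒞) ∨ (A \ B ∈ 𝒞 ∧ B \ A ∈ 𝒞)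

/-- The family `𝒞` is uncrossable. -/
def uncrossable {V : Type*} (𝒞 : Set (Set V)) : Prop :=
  ∀ A B, A ∈ 𝒞 → B ∈ 𝒞 → properlyIntersect A B → uncross 𝒞 A B

section Cut

variable {V E : Type*} {ends : E → Sym2 V}

theorem crosses_iff {A : Set V} {e : E} {u v : V} (h : ends e = s(u, v)) :
    crosses ends A e ↔ ¬(u ∈ A ↔ v ∈ A) := by
  constructor
  · rintro ⟨x, y, hxy, hx, hy⟩
    rw [h, Sym2.eq_iff] at hxy
    rcases hxy with ⟨rfl, rfl⟩ | ⟨rfl, rfl⟩ <;> tauto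
  · intro hA
    by_cases hu : u ∈ A
    · exact ⟨u, v, h, hu, by tauto⟩
    · exact ⟨v, u, h.trans Sym2.eq_swap, by tauto, hu⟩

theorem cut_compl (F : Set E) (A : Set V) : cut ends F Aᶜ = cut ends F A := by
  ext e
  obtain ⟨u, v, h⟩ : ∃ u v, ends e = s(u, v) := ⟨_, _, (Quot.out_eq (ends e)).symm⟩
  simp only [cut, Set.mem_ofPred_eq, crosses_iff h, Set.mem_compl_iff]
  tauto

/-- If the indicator of `T` is a function of those of `P` and `Q`, then every edge crossing `T`
crosses `P` or `Q`. -/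
theorem cut_subset_union {T P Q : Set V} (F : Set E)
    (h : ∀ u v, (u ∈ P ↔ v ∈ P) → (u ∈ Q ↔ v ∈ Q) → (u ∈ T → v ∈ T)) :
    cut ends F T ⊆ cut ends F P ∪ cut ends F Q := by
  rintro e ⟨he, u, v, huv, hu, hv⟩
  simp only [cut, Set.mem_union, Set.mem_ofPred_eq, crosses_iff huv]
  have := h u v
  tauto

variable [Finite E]

theorem ncard_cut_inter_add_union_le (F : Set E) (A B : Set V) :
    (cut ends F (A ∩ B)).ncard + (cut ends F (A ∪ B)).ncard ≤
      (cut ends F A).ncard + (cut ends F B).ncard := by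
  rw [← Set.ncard_union_add_ncard_inter, ← Set.ncard_union_add_ncard_inter (cut ends F A)]
  refine add_le_add (Set.ncard_le_ncard ?_) (Set.ncard_le_ncard ?_)
  all_goals
    intro e
    obtain ⟨u, v, h⟩ : ∃ u v, ends e = s(u, v) := ⟨_, _, (Quot.out_eq (ends e)).symm⟩
    simp only [cut, Set.mem_union, Set.mem_inter_iff, Set.mem_ofPred_eq, crosses_iff h]
    tauto

theorem ncard_cut_diff_add_diff_le (F : Set E) (A B : Set V) :
    (cut ends F (A \ B)).ncard + (cut ends F (B \ A)).ncard ≤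
      (cut ends F A).ncard + (cut ends F B).ncard := by
  have h := ncard_cut_inter_add_union_le (ends := ends) F A Bᶜ
  have hBA : A ∪ Bᶜ = (B \ A)ᶜ := by
    ext x
    simp only [Set.mem_union, Set.mem_compl_iff, Set.mem_sdiff]
    tauto
  rwa [hBA, cut_compl, cut_compl, ← Set.sdiff_eq] at h

theorem ncard_cut_eq_safe_add_unsafe (H 𝒮 : Set E) (A : Set V) :
    (cut ends H A).ncard =
      (cut ends (H ∩ 𝒮) A).ncard + (cut ends (H \ 𝒮) A).ncard := by
  rw [← Set.ncard_inter_add_ncard_sdiff_eq_ncard (cut ends H A) 𝒮]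
  congr 2 <;>
  · ext e
    simp only [cut, Set.mem_inter_iff, Set.mem_sdiff, Set.mem_ofPred_eq]
    tauto

/-- For `q ≤ 2`, a cut of at least `p + q` edges, fewer than `p` of them safe, cannot be covered
by two cuts that each have fewer than `p + q` edges and at least `p` safe ones. -/
theorem le_ncard_cut_of_subset_union {H 𝒮 : Set E} {p q : ℕ} {T P Q : Set V} (hq : q ≤ 2)
    (hT : p + q ≤ (cut ends H T).ncard) (hTs : (cut ends (H ∩ 𝒮) T).ncard < p)
    (hP : p ≤ (cut ends (H ∩ 𝒮) P).ncard ∨ p + q ≤ (cut ends H P).ncard)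
    (hQ : p ≤ (cut ends (H ∩ 𝒮) Q).ncard ∨ p + q ≤ (cut ends H Q).ncard)
    (h : ∀ u v, (u ∈ P ↔ v ∈ P) → (u ∈ Q ↔ v ∈ Q) → (u ∈ T → v ∈ T)) :
    p + q ≤ (cut ends H P).ncard ∨ p + q ≤ (cut ends H Q).ncard := by
  have hsub := (Set.ncard_le_ncard (cut_subset_union (ends := ends) (H \ 𝒮) h)).trans
    (Set.ncard_union_le _ _)
  have h₁ := ncard_cut_eq_safe_add_unsafe (ends := ends) H 𝒮 T
  have h₂ := ncard_cut_eq_safe_add_unsafe (ends := ends) H 𝒮 P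
  have h₃ := ncard_cut_eq_safe_add_unsafe (ends := ends) H 𝒮 Q
  omega

end Cut

theorem stmt9 {V E : Type*} [Fintype V] [Fintype E]
    (ends : E → Sym2 V) (𝒮 𝒰 : Set E)
    (hpart : 𝒮 ∪ 𝒰 = Set.univ) (hdisj : Disjoint 𝒮 𝒰)
    (p q i : ℕ) (hp : 1 ≤ p) (hq : q ≤ 2) (hi : i ≤ p - 1)
    (H : Set E) (hfeas : fgcFeasible ends 𝒮 p q H)
    (hH : ∀ A : Set V, A.Nonempty → A ≠ Set.univ →
      (cut ends H A).ncard = p + q → i ≤ (cut ends (H ∩ 𝒮) A).ncard) :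
    uncrossable {A : Set V | A.Nonempty ∧ A ≠ Set.univ ∧
      (cut ends H A).ncard = p + q ∧ (cut ends (H ∩ 𝒮) A).ncard = i} := by
  rintro A B ⟨-, hA, hdA, hsA⟩ ⟨-, hB, hdB, hsB⟩ ⟨hX, hY, hZ⟩
  by_cases hW : A ∪ B = Set.univ
  · have hAB : A \ B = Bᶜ := by rw [← Set.union_sdiff_right, hW, Set.compl_eq_univ_sdiff]
    have hBA : B \ A = Aᶜ := by
      rw [← Set.union_sdiff_right, Set.union_comm, hW, Set.compl_eq_univ_sdiff]
    refine Or.inr ⟨⟨hY, ?_, ?_⟩, hZ, ?_, ?_⟩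
    · exact fun h => hB (Set.eq_univ_of_univ_subset (by grind))
    · rw [hAB, cut_compl, cut_compl]
      exact ⟨hdB, hsB⟩
    · exact fun h => hA (Set.eq_univ_of_univ_subset (by grind))
    · rw [hBA, cut_compl, cut_compl]
      exact ⟨hdA, hsA⟩
  have hX' : A ∩ B ≠ Set.univ := fun h => hA (by grind)
  have hY' : A \ B ≠ Set.univ := fun h => hA (by grind)
  have hZ' : B \ A ≠ Set.univ := fun h => hB (by grind)
  have hW' : (A ∪ B).Nonempty := hX.mono fun x hx => Or.inl hx.1
  have hsA_lt : (cut ends (H ∩ 𝒮) A).ncard < p := by omega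
  have hsB_lt : (cut ends (H ∩ 𝒮) B).ncard < p := by omega
  have fX := hfeas _ hX hX'
  have fY := hfeas _ hY hY'
  have fZ := hfeas _ hZ hZ'
  have fW := hfeas _ hW' hW
  have iX := hH _ hX hX'
  have iY := hH _ hY hY'
  have iZ := hH _ hZ hZ'
  have iW := hH _ hW' hW
  have subH := ncard_cut_inter_add_union_le (ends := ends) H A B
  have subS := ncard_cut_inter_add_union_le (ends := ends) (H ∩ 𝒮) A B
  have posiH := ncard_cut_diff_add_diff_le (ends := ends) H A B
  have posiS := ncard_cut_diff_add_diff_le (ends := ends) (H ∩ 𝒮) A B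
  have cXY := le_ncard_cut_of_subset_union (T := A) hq hdA.ge hsA_lt fX fY
    fun u v => by grind
  have cXZ := le_ncard_cut_of_subset_union (T := B) hq hdB.ge hsB_lt fX fZ
    fun u v => by grind
  have cWY := le_ncard_cut_of_subset_union (T := B) hq hdB.ge hsB_lt fW fY
    fun u v => by grind
  have cWZ := le_ncard_cut_of_subset_union (T := A) hq hdA.ge hsA_lt fW fZ
    fun u v => by grind
  have key : (p + q ≤ (cut ends H (A ∩ B)).ncard ∧ p + q ≤ (cut ends H (A ∪ B)).ncard) ∨
      (p + q ≤ (cut ends H (A \ B)).ncard ∧ p + q ≤ (cut ends H (B \ A)).ncard) := by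
    clear fX fY fZ fW iX iY iZ iW subH subS posiH posiS
    tauto
  clear cXY cXZ cWY cWZ fX fY fZ fW
  rcases key with ⟨hdX, hdW⟩ | ⟨hdY, hdZ⟩
  · have eX : (cut ends H (A ∩ B)).ncard = p + q := by omega
    have eW : (cut ends H (A ∪ B)).ncard = p + q := by omega
    specialize iX eX
    specialize iW eW
    exact Or.inl ⟨⟨hX, hX', eX, by omega⟩, hW', hW, eW, by omega⟩
  · have eY : (cut ends H (A \ B)).ncard = p + q := by omega
    have eZ : (cut ends H (B \ A)).ncard = p + q := by omega
    specialize iY eY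
    specialize iZ eZ
    exact Or.inr ⟨⟨hY, hY', eY, by omega⟩, hZ, hZ', eZ, by omega⟩
end

section
/- There exist a multigraph (a finite vertex type V, finite edge type E, endpoint map ends : E → Sym2 V) with a partition of E into safe edges 𝒮 and unsafe edges 𝒰, a set F ⊆ E feasible for (3,1)-FGC, and properly intersecting sets A, B ⊆ V that are both violated for the augmentation from (3,1)-FGC to (3,2)-FGC — i.e., |δ_F(A)| = |δ_F(B)| = 4 and |δ_{F∩𝒮}(A)| ≤ 2, |δ_{F∩𝒮}(B)| ≤ 2 — such that A and B do not uncross in the family of violated cuts: it is not the case that both A ∩ B and A ∪ B are violated, nor that both A \ B and B \ A are violated. -/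
open scoped BigOperators

/-- The tails of the edges of the doubled 4-cycle `0 - 1 - 3 - 2 - 0`. -/
def doubledCycleTail : Fin 8 → Fin 4 := ![0, 0, 0, 0, 1, 1, 2, 2]

/-- The heads of the edges of the doubled 4-cycle `0 - 1 - 3 - 2 - 0`. -/
def doubledCycleHead : Fin 8 → Fin 4 := ![1, 1, 2, 2, 3, 3, 3, 3]

theorem crosses_iff_of_ends {V E : Type*} (a b : E → V) (A : Set V) (e : E) :
    crosses (fun e => s(a e, b e)) A e ↔ ¬(a e ∈ A ↔ b e ∈ A) := by
  constructor
  · rintro ⟨u, v, h, hu, hv⟩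
    rcases Sym2.eq_iff.1 h with ⟨rfl, rfl⟩ | ⟨rfl, rfl⟩ <;> tauto
  · intro h
    by_cases ha : a e ∈ A
    · exact ⟨a e, b e, rfl, ha, by tauto⟩
    · exact ⟨b e, a e, Sym2.eq_swap, by tauto, ha⟩

theorem ncard_cut_coe {V E : Type*} [DecidableEq V] (a b : E → V)
    (F : Finset E) (A : Finset V) :
    (cut (fun e => s(a e, b e)) (F : Set E) (A : Set V)).ncard =
      (F.filter fun e => ¬(a e ∈ A ↔ b e ∈ A)).card := by
  rw [← Set.ncard_coe_finset]
  congr 1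
  ext e
  simp [cut, crosses_iff_of_ends]

theorem four_le_card_doubledCycle_cut (A : Finset (Fin 4)) (hne : A.Nonempty)
    (huniv : A ≠ Finset.univ) :
    4 ≤ (Finset.univ.filter fun e =>
      ¬(doubledCycleTail e ∈ A ↔ doubledCycleHead e ∈ A)).card := by
  revert A
  decide

theorem stmt12 :
    ∃ (V E : Type) (_ : Fintype V) (_ : Fintype E) (ends : E → Sym2 V)
      (𝒮 𝒰 : Set E) (F : Set E) (A B : Set V),
      𝒮 ∪ 𝒰 = Set.univ ∧ Disjoint 𝒮 𝒰 ∧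
      fgcFeasible ends 𝒮 3 1 F ∧
      properlyIntersect A B ∧
      (cut ends F A).ncard = 4 ∧ (cut ends F B).ncard = 4 ∧
      (cut ends (F ∩ 𝒮) A).ncard ≤ 2 ∧ (cut ends (F ∩ 𝒮) B).ncard ≤ 2 ∧
      ¬(((cut ends F (A ∩ B)).ncard = 4 ∧ (cut ends (F ∩ 𝒮) (A ∩ B)).ncard ≤ 2) ∧
        ((cut ends F (A ∪ B)).ncard = 4 ∧ (cut ends (F ∩ 𝒮) (A ∪ B)).ncard ≤ 2)) ∧
      ¬(((cut ends F (A \ B)).ncard = 4 ∧ (cut ends (F ∩ 𝒮) (A \ B)).ncard ≤ 2) ∧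
        ((cut ends F (B \ A)).ncard = 4 ∧ (cut ends (F ∩ 𝒮) (B \ A)).ncard ≤ 2)) := by
  refine ⟨Fin 4, Fin 8, inferInstance, inferInstance,
    fun e => s(doubledCycleTail e, doubledCycleHead e),
    (({0, 1, 2, 4} : Finset (Fin 8)) : Set (Fin 8)),
    (({0, 1, 2, 4} : Finset (Fin 8)) : Set (Fin 8))ᶜ,
    ((Finset.univ : Finset (Fin 8)) : Set (Fin 8)),
    (({0, 1} : Finset (Fin 4)) : Set (Fin 4)), (({0, 2} : Finset (Fin 4)) : Set (Fin 4)),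
    Set.union_compl_self _, disjoint_compl_right, ?_, ?_, ?_⟩
  · intro A hne huniv
    right
    lift A to Finset (Fin 4) using A.toFinite
    rw [ncard_cut_coe]
    exact four_le_card_doubledCycle_cut A (by simpa using hne) (by simpa using huniv)
  · exact ⟨⟨0, by simp⟩, ⟨1, by simp⟩, ⟨2, by simp⟩⟩
  · simp only [← Finset.coe_inter, ← Finset.coe_union, ← Finset.coe_sdiff, ncard_cut_coe]
    decide
end
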